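/- Let G be a vertex-weighted graph containing a 4-cycle v₁v₂v₃v₄ (i.e., v₁v₂, v₂v₃, v₃v₄, v₄v₁ are edges on four distinct vertices) such that d(v₂)=d(v₃)=2 and w(v₁) ≥ w(v₂) ≥ w(v₃). Let G' be the graph obtained from G by removing v₂ and v₃ and replacing the weight of v₁ by w(v₁)+w(v₃)−w(v₂). Then α(G) = α(G') + w(v₂). -/

import Mathlib

open scoped Classical

namespace MWIS

variable {V : Type*}

/-- A finset of vertices is an independent set of `G`. -/
def IsIndepSet (G : SimpleGraph V) (s : Finset V) : Prop :=
  ∀ ⦃a⦄, a ∈ s → ∀ ⦃b⦄, b ∈ s → ¬G.Adj a b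

/-- The maximum total weight of an independent set of `G` contained in `A`
(i.e. α of the induced subgraph `G[A]`, with the inherited weights). -/
noncomputable def alphaOn [Fintype V] (G : SimpleGraph V) (w : V → ℝ) (A : Finset V) : ℝ :=
  sSup {x : ℝ | ∃ s : Finset V, s ⊆ A ∧ IsIndepSet G s ∧ x = ∑ v ∈ s, w v}

/-- The maximum total weight of an independent set of `G`. -/
noncomputable def alpha [Fintype V] (G : SimpleGraph V) (w : V → ℝ) : ℝ :=
  alphaOn G w Finset.univ

/-- The open neighborhood of a vertex, as a finset. -/
noncomputable def nbrs [Fintype V] (G : SimpleGraph V) (v : V) : Finset V :=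
  Finset.univ.filter fun u => G.Adj v u

/-- The degree of a vertex. -/
noncomputable def deg [Fintype V] (G : SimpleGraph V) (v : V) : ℕ :=
  (nbrs G v).card

/-- The closed neighborhood `N[v]` of a vertex. -/
noncomputable def closedNbrs [Fintype V] [DecidableEq V] (G : SimpleGraph V) (v : V) : Finset V :=
  insert v (nbrs G v)

/-- The open neighborhood `N(A)` of a vertex set. -/
noncomputable def openNbhd [Fintype V] [DecidableEq V] (G : SimpleGraph V) (A : Finset V) :
    Finset V :=
  (A.biUnion fun v => nbrs G v) \ A

/-- The closed neighborhood `N[A]` of a vertex set. -/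
noncomputable def closedNbhd [Fintype V] [DecidableEq V] (G : SimpleGraph V) (A : Finset V) :
    Finset V :=
  A ∪ A.biUnion fun v => nbrs G v

/-- `s` is a maximum weighted independent set of `G` with weights `w`. -/
def IsMWIS [Fintype V] (G : SimpleGraph V) (w : V → ℝ) (s : Finset V) : Prop :=
  IsIndepSet G s ∧ ∀ t : Finset V, IsIndepSet G t → ∑ v ∈ t, w v ≤ ∑ v ∈ s, w v

/-- `A` is the vertex set of a connected component of the subgraph of `G` induced on `B`:
`A` is the set of vertices reachable from some `x ∈ B` by paths staying inside `B`. -/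
def IsCompOf (G : SimpleGraph V) (B A : Finset V) : Prop :=
  ∃ x ∈ B, ∀ y, y ∈ A ↔ Relation.ReflTransGen (fun a b => a ∈ B ∧ b ∈ B ∧ G.Adj a b) x y

lemma IsIndepSet.mono {G : SimpleGraph V} {s t : Finset V} (hs : IsIndepSet G s) (h : t ⊆ s) :
    IsIndepSet G t :=
  fun _ ha _ hb => hs (h ha) (h hb)

lemma IsIndepSet.insert [DecidableEq V] {G : SimpleGraph V} {s : Finset V} {v : V}
    (hs : IsIndepSet G s) (hv : ∀ u ∈ s, ¬G.Adj v u) : IsIndepSet G (insert v s) := by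
  intro a ha b hb hab
  rcases Finset.mem_insert.1 ha with rfl | has <;> rcases Finset.mem_insert.1 hb with rfl | hbs
  · exact G.irrefl hab
  · exact hv b hbs hab
  · exact hv a has hab.symm
  · exact hs has hbs hab

lemma sum_le_alphaOn [Fintype V] {G : SimpleGraph V} (w : V → ℝ) {A s : Finset V}
    (hsA : s ⊆ A) (hs : IsIndepSet G s) : ∑ v ∈ s, w v ≤ alphaOn G w A := by
  refine le_csSup (Set.Finite.bddAbove ?_) ⟨s, hsA, hs, rfl⟩
  refine (Set.finite_range fun t : Finset V => ∑ v ∈ t, w v).subset ?_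
  rintro _ ⟨t, -, -, rfl⟩
  exact ⟨t, rfl⟩

lemma alphaOn_le [Fintype V] {G : SimpleGraph V} {w : V → ℝ} {A : Finset V} {c : ℝ}
    (h : ∀ s ⊆ A, IsIndepSet G s → ∑ v ∈ s, w v ≤ c) : alphaOn G w A ≤ c := by
  refine csSup_le ⟨0, ∅, Finset.empty_subset A, ?_, by simp⟩ ?_
  · intro a ha
    simp at ha
  · rintro _ ⟨s, hsA, hs, rfl⟩
    exact h s hsA hs

lemma eq_or_eq_of_deg_eq_two [Fintype V] {G : SimpleGraph V} {v a b u : V} (hd : deg G v = 2)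
    (hab : a ≠ b) (ha : G.Adj v a) (hb : G.Adj v b) (hu : G.Adj v u) : u = a ∨ u = b := by
  have hsub : ({a, b} : Finset V) ⊆ nbrs G v := by
    intro x hx
    rcases Finset.mem_insert.1 hx with rfl | hx
    · simpa [nbrs] using ha
    · rw [Finset.mem_singleton.1 hx]
      simpa [nbrs] using hb
  have heq := Finset.eq_of_subset_of_card_le hsub (by rw [Finset.card_pair hab]; exact hd.le)
  have hmem : u ∈ nbrs G v := by simpa [nbrs] using hu
  simpa [← heq] using hmem

lemma sum_update_eq_add_ite [DecidableEq V] (w : V → ℝ) (s : Finset V) (a : V) (c : ℝ) :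
    ∑ v ∈ s, Function.update w a c v = ∑ v ∈ s, w v + if a ∈ s then c - w a else 0 := by
  by_cases ha : a ∈ s
  · rw [Finset.sum_update_of_mem ha, ← Finset.add_sum_erase s w ha, Finset.sdiff_singleton_eq_erase,
      if_pos ha]
    ring
  · rw [Finset.sum_update_of_notMem ha, if_neg ha, add_zero]

/-- for a 4-cycle `v₁v₂v₃v₄` with `d(v₂) = d(v₃) = 2` and
`w(v₁) ≥ w(v₂) ≥ w(v₃)`: remove `v₂, v₃` and give `v₁` the weight
`w(v₁) + w(v₃) − w(v₂)`. Then `α(G) = α(G') + w(v₂)`. -/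
theorem stmt7 [Fintype V] [DecidableEq V] (G : SimpleGraph V) (w : V → ℝ)
    (hw : ∀ x, 0 < w x) (v₁ v₂ v₃ v₄ : V)
    (h12 : v₁ ≠ v₂) (h13 : v₁ ≠ v₃) (h14 : v₁ ≠ v₄)
    (h23 : v₂ ≠ v₃) (h24 : v₂ ≠ v₄) (h34 : v₃ ≠ v₄)
    (e12 : G.Adj v₁ v₂) (e23 : G.Adj v₂ v₃) (e34 : G.Adj v₃ v₄) (e41 : G.Adj v₄ v₁)
    (hd2 : deg G v₂ = 2) (hd3 : deg G v₃ = 2)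
    (hw12 : w v₂ ≤ w v₁) (hw23 : w v₃ ≤ w v₂) :
    alpha G w =
      alphaOn G (Function.update w v₁ (w v₁ + w v₃ - w v₂))
        (Finset.univ \ {v₂, v₃}) + w v₂ := by
  apply le_antisymm
  · refine alphaOn_le fun s _ hs => ?_
    have key : ∀ t ⊆ s, v₂ ∉ t → v₃ ∉ t →
        ∑ v ∈ t, w v + (if v₁ ∈ t then w v₁ + w v₃ - w v₂ - w v₁ else 0) ≤
          alphaOn G (Function.update w v₁ (w v₁ + w v₃ - w v₂)) (Finset.univ \ {v₂, v₃}) := by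
      intro t hts ht2 ht3
      rw [← sum_update_eq_add_ite]
      refine sum_le_alphaOn _ (fun x hx => ?_) (hs.mono hts)
      have hx2 : x ≠ v₂ := fun h => ht2 (h ▸ hx)
      have hx3 : x ≠ v₃ := fun h => ht3 (h ▸ hx)
      simp [hx2, hx3]
    by_cases m2 : v₂ ∈ s
    · have m1 : v₁ ∉ s := fun h => hs h m2 e12
      have m3 : v₃ ∉ s := fun h => hs m2 h e23
      have := key (s.erase v₂) (Finset.erase_subset _ _) (by simp) (by simp [m3])
      rw [if_neg (by simp [m1])] at this
      linarith [Finset.add_sum_erase s w m2]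
    · by_cases m3 : v₃ ∈ s
      · have := key (s.erase v₃) (Finset.erase_subset _ _) (by simp [m2]) (by simp)
        have := Finset.add_sum_erase s w m3
        split_ifs at * <;> linarith
      · have := key s subset_rfl m2 m3
        have := hw v₃
        have := hw v₂
        split_ifs at * <;> linarith
  · rw [← le_sub_iff_add_le]
    refine alphaOn_le fun s hsA hs => ?_
    have m2 : v₂ ∉ s := fun h => by simpa using hsA h
    have m3 : v₃ ∉ s := fun h => by simpa using hsA h
    rw [sum_update_eq_add_ite]
    by_cases m1 : v₁ ∈ s
    · have m4 : v₄ ∉ s := fun h => hs h m1 e41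
      have hins : IsIndepSet G (insert v₃ s) := hs.insert fun u hu hadj => by
        rcases eq_or_eq_of_deg_eq_two hd3 h24 e23.symm e34 hadj with rfl | rfl
        · exact m2 hu
        · exact m4 hu
      have := sum_le_alphaOn w (Finset.subset_univ _) hins
      rw [Finset.sum_insert m3] at this
      rw [if_pos m1, alpha]
      linarith
    · have hins : IsIndepSet G (insert v₂ s) := hs.insert fun u hu hadj => by
        rcases eq_or_eq_of_deg_eq_two hd2 h13 e12.symm e23 hadj with rfl | rfl
        · exact m1 hu
        · exact m3 hu
      have := sum_le_alphaOn w (Finset.subset_univ _) hins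
      rw [Finset.sum_insert m2] at this
      rw [if_neg m1, alpha]
      linarith

end MWIS
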